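/- Let n, k, t be integers with t = α(n) − O(1) and n/k = t − Θ(1). Let P'_{n,k,t} ⊂ P_{n,k,t} be the set of all t-bounded complete k-colouring profiles on n vertices in which k_s > 0 for some s < α − 10·√(ln n). Then Σ_{k ∈ P'_{n,k,t}} E_{1/2}[X̄_k] = o(E_{n,k,t}) as n → ∞. -/

import Mathlib

open Filter
open scoped BigOperators Classical

noncomputable section

/-- The number of edges of a simple graph on `Fin n`. -/
def edgeCount {n : ℕ} (G : SimpleGraph (Fin n)) : ℕ := Nat.card G.edgeSet

/-- Probability of a graph property under the uniform random graph `G(n,m)`. -/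
def Pm (n m : ℕ) (E : SimpleGraph (Fin n) → Prop) : ℝ :=
  (Nat.card {G : SimpleGraph (Fin n) // edgeCount G = m ∧ E G} : ℝ) /
    (Nat.card {G : SimpleGraph (Fin n) // edgeCount G = m} : ℝ)

/-- Expectation of a real functional under the uniform random graph `G(n,m)`. -/
def Em (n m : ℕ) (X : SimpleGraph (Fin n) → ℝ) : ℝ :=
  (∑ᶠ G : {G : SimpleGraph (Fin n) // edgeCount G = m}, X G.1) /
    (Nat.card {G : SimpleGraph (Fin n) // edgeCount G = m} : ℝ)

/-- Probability of a graph property under the binomial random graph `G(n,p)`. -/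
def Pp (n : ℕ) (p : ℝ) (E : SimpleGraph (Fin n) → Prop) : ℝ :=
  ∑ᶠ G : SimpleGraph (Fin n),
    (if E G then (1 : ℝ) else 0) * p ^ edgeCount G * (1 - p) ^ (n.choose 2 - edgeCount G)

/-- Expectation of a real functional under the binomial random graph `G(n,p)`. -/
def Ep (n : ℕ) (p : ℝ) (X : SimpleGraph (Fin n) → ℝ) : ℝ :=
  ∑ᶠ G : SimpleGraph (Fin n),
    X G * p ^ edgeCount G * (1 - p) ^ (n.choose 2 - edgeCount G)

/-- `α₀(n) = 2 log_b n − 2 log_b log_b n + 2 log_b (e/2) + 1`. -/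
def alpha0 (b : ℝ) (n : ℕ) : ℝ :=
  2 * Real.logb b n - 2 * Real.logb b (Real.logb b n) + 2 * Real.logb b (Real.exp 1 / 2) + 1

/-- `α(n) = ⌊α₀(n)⌋`. -/
def alphaNat (b : ℝ) (n : ℕ) : ℕ := ⌊alpha0 b n⌋₊

/-- `μ_t = C(n,t) q^{C(t,2)}`, the expected number of independent `t`-sets. -/
def muExp (q : ℝ) (n t : ℕ) : ℝ := (n.choose t : ℝ) * q ^ t.choose 2

/-- A finset of vertices is independent in `G`. -/
def IndepFinset {n : ℕ} (G : SimpleGraph (Fin n)) (s : Finset (Fin n)) : Prop :=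
  ∀ v ∈ s, ∀ w ∈ s, ¬ G.Adj v w

/-- `G` has a proper colouring with `k` colours, all colour classes of size at most `t`. -/
def HasBoundedColouring {n : ℕ} (G : SimpleGraph (Fin n)) (t k : ℕ) : Prop :=
  ∃ C : Fin n → Fin k, (∀ v w, G.Adj v w → C v ≠ C w) ∧
    ∀ c : Fin k, (Finset.univ.filter fun v => C v = c).card ≤ t

/-- The `t`-bounded chromatic number `χ_t(G)`. -/
def chiBounded {n : ℕ} (G : SimpleGraph (Fin n)) (t : ℕ) : ℕ :=
  sInf {k | HasBoundedColouring G t k}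

/-- `G` has an equitable proper colouring with `k` colours. -/
def HasEquitableColouring {n : ℕ} (G : SimpleGraph (Fin n)) (k : ℕ) : Prop :=
  ∃ C : Fin n → Fin k, (∀ v w, G.Adj v w → C v ≠ C w) ∧
    ∀ c c' : Fin k,
      (Finset.univ.filter fun v => C v = c).card ≤
        (Finset.univ.filter fun v => C v = c').card + 1

/-- The equitable chromatic number `χ₌(G)`. -/
def chiEquitable {n : ℕ} (G : SimpleGraph (Fin n)) : ℕ :=
  sInf {k | HasEquitableColouring G k}

/-- The number of unordered `t`-bounded proper `k`-colourings of `G`, i.e. partitions of the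
vertex set into exactly `k` nonempty independent sets, each of size at most `t`. -/
def numUnorderedColourings (n t k : ℕ) (G : SimpleGraph (Fin n)) : ℕ :=
  Set.ncard {Q : Finset (Finset (Fin n)) | Q.card = k ∧
    (∀ s ∈ Q, s.Nonempty ∧ s.card ≤ t ∧ IndepFinset G s) ∧
    (∀ v : Fin n, ∃ s ∈ Q, v ∈ s) ∧
    ∀ s ∈ Q, ∀ s' ∈ Q, s ≠ s' → Disjoint s s'}

/-- `E_{n,k,t}`: the expected number of unordered `t`-bounded `k`-colourings of `G_{n,1/2}`. -/
def Enkt (n k t : ℕ) : ℝ := Ep n (1/2) fun G => (numUnorderedColourings n t k G : ℝ)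

/-- The `t`-bounded first moment threshold `k_t(n)`. -/
def fmThreshold (n t : ℕ) : ℕ := sInf {k | 1 ≤ Enkt n k t}

/-- `P` is a (possibly partial) `k`-colouring profile on `n` vertices. -/
def IsProfile (n k : ℕ) (P : ℕ → ℕ) : Prop :=
  (∀ u, u ∉ Finset.Icc 1 n → P u = 0) ∧
    (∑ u ∈ Finset.Icc 1 n, P u = k) ∧ (∑ u ∈ Finset.Icc 1 n, u * P u ≤ n)

/-- A colouring profile is complete if its classes use all `n` vertices. -/
def IsCompleteProfile (n : ℕ) (P : ℕ → ℕ) : Prop :=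
  ∑ u ∈ Finset.Icc 1 n, u * P u = n

/-- A colouring profile is `t`-bounded if it has no classes of size larger than `t`. -/
def IsBoundedProfile (t : ℕ) (P : ℕ → ℕ) : Prop := ∀ u, t < u → P u = 0

/-- The number of parts of a profile on `n` vertices. -/
def profileParts (n : ℕ) (P : ℕ → ℕ) : ℕ := ∑ u ∈ Finset.Icc 1 n, P u

/-- `X_k`: the number of ordered (partial) proper colourings of `G` with profile `P`:
ordered tuples of pairwise disjoint independent sets, decreasing in size, with exactly
`P u` parts of size `u` for every `u`. -/
def Xprofile {n : ℕ} (G : SimpleGraph (Fin n)) (P : ℕ → ℕ) : ℕ :=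
  Set.ncard {V : Fin (profileParts n P) → Finset (Fin n) |
    (∀ i j, i ≠ j → Disjoint (V i) (V j)) ∧
    (∀ i j, i ≤ j → (V j).card ≤ (V i).card) ∧
    (∀ u : ℕ, (Finset.univ.filter fun i => (V i).card = u).card = P u) ∧
    ∀ i, IndepFinset G (V i)}

/-- `X̄_k = X_k / ∏_u k_u!`: the number of unordered colourings with profile `P`. -/
def Xbar {n : ℕ} (G : SimpleGraph (Fin n)) (P : ℕ → ℕ) : ℝ :=
  (Xprofile G P : ℝ) / ∏ u ∈ Finset.Icc 1 n, ((P u).factorial : ℝ)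

/-- `κ = Σ_u κ_u` where `κ_u = u k_u / n`. -/
def kappaTot (n : ℕ) (P : ℕ → ℕ) : ℝ := ∑ u ∈ Finset.Icc 1 n, (u : ℝ) * P u / n

/-- `m = ⌊p N⌋` with `N = C(n,2)`. -/
def mFloor (p : ℝ) (n : ℕ) : ℕ := ⌊p * (n.choose 2 : ℝ)⌋₊

/-- Definition 2.2: a sequence `P` of complete `a`-bounded colouring profiles is tame. -/
def IsTame (p : ℝ) (a : ℕ → ℕ) (P : ℕ → ℕ → ℕ) : Prop :=
  (∃ C : ℝ, ∀ᶠ n in atTop, alpha0 (1/(1-p)) n - C ≤ (a n : ℝ)) ∧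
  (∀ᶠ n in atTop, a n ≤ alphaNat (1/(1-p)) n) ∧
  (∀ n, IsProfile n (profileParts n (P n)) (P n) ∧ IsCompleteProfile n (P n) ∧
      IsBoundedProfile (a n) (P n)) ∧
  ∃ c : ℝ, c ∈ Set.Ioo (0:ℝ) 1 ∧ ∃ γ : ℕ → ℝ, Monotone γ ∧ Tendsto γ atTop atTop ∧
    (∀ᶠ n in atTop, ∀ u, 1 ≤ u → u ≤ a n →
      (u : ℝ) * P n u / n <
        (1/(1-p)) ^ (-(((alphaNat (1/(1-p)) n - u : ℕ) : ℝ) *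
          γ (alphaNat (1/(1-p)) n - u)))) ∧
    ∀ ε : ℝ, 0 < ε → ∀ᶠ n : ℕ in atTop,
      Real.exp (-ε * (n : ℝ) ^ ((1:ℝ) - c)) ≤ Em n (mFloor p n) fun G => Xbar G (P n)

/-- The function `φ(κ)` from Lemma 3.3. -/
def phiProfile (p : ℝ) (n : ℕ) (P : ℕ → ℕ) : ℝ :=
  -(1 - kappaTot n P) * Real.log (1 - kappaTot n P) +
    Real.log (1/(1-p)) / 2 * ∑ u ∈ Finset.Icc 1 n,
      ((u : ℝ) * P u / n) * (alpha0 (1/(1-p)) n - 1 - 2 / Real.log (1/(1-p)) - (u : ℝ))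

/-- The function `φ̃_δ(x)` from Lemma 3.5. -/
def phiTilde (p δ x : ℝ) : ℝ :=
  -(1 - x) * Real.log (1 - x) - (1 - Real.log (1/(1-p)) / 2 * δ) * x

/-- `d_u = 2^{C(u,2)} u!`. -/
def dcoef (u : ℕ) : ℝ := 2 ^ u.choose 2 * (u.factorial : ℝ)

/-- `L_0(n,k,t)`: the supremum of `L_k` over real-valued `t`-bounded complete profiles. -/
def L0 (n k t : ℕ) : ℝ :=
  sSup {y : ℝ | ∃ f : ℕ → ℝ, (∀ u ∈ Finset.Icc 1 t, 0 ≤ f u) ∧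
    (∑ u ∈ Finset.Icc 1 t, f u = (k : ℝ)) ∧ (∑ u ∈ Finset.Icc 1 t, (u : ℝ) * f u = (n : ℝ)) ∧
    y = (n : ℝ) * Real.log n - (n : ℝ) + (k : ℝ) -
      ∑ u ∈ Finset.Icc 1 t, f u * Real.log (f u * dcoef u)}

/-- Membership in `P_{n,k,t}`: a `t`-bounded complete `k`-colouring profile on `n` vertices. -/
def IsKTProfile (n k t : ℕ) (P : ℕ → ℕ) : Prop :=
  (∀ u, u ∉ Finset.Icc 1 t → P u = 0) ∧
    (∑ u ∈ Finset.Icc 1 t, P u = k) ∧ (∑ u ∈ Finset.Icc 1 t, u * P u = n)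

/-- `E_{n,k,t}` written as the sum over profiles of `E_{1/2}[X̄_k]`. -/
def EnktSum (n k t : ℕ) : ℝ :=
  ∑ᶠ P : ℕ → ℕ, if IsKTProfile n k t P then Ep n (1/2) fun G => Xbar G P else 0


lemma sc_edges_disj {n m : ℕ} (V : Fin m → Finset (Fin n))
    (hV : ∀ i j, i ≠ j → Disjoint (V i) (V j)) :
    (Finset.univ.biUnion fun i => (V i).offDiag.image Sym2.mk.uncurry).card
      = ∑ i, ((V i).card).choose 2 := by
  rw [Finset.card_biUnion]
  · refine Finset.sum_congr rfl fun i _ => ?_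
    exact Sym2.card_image_offDiag (V i)
  · intro i _ j _ hij
    simp only [Function.onFun]
    rw [Finset.disjoint_left]
    intro e he he'
    simp only [Finset.mem_image, Finset.mem_offDiag, Prod.exists] at he he'
    obtain ⟨x, y, ⟨hx, hy, _⟩, rfl⟩ := he
    obtain ⟨x', y', ⟨hx', hy', _⟩, h⟩ := he'
    have hd := hV i j hij
    rw [Finset.disjoint_left] at hd
    simp only [Function.uncurry, Sym2.eq_iff] at h
    rcases h with ⟨rfl, rfl⟩ | ⟨rfl, rfl⟩
    · exact hd hx hx'
    · exact hd hy hx'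

lemma sc_graph_count {n m : ℕ} (V : Fin m → Finset (Fin n))
    (hV : ∀ i j, i ≠ j → Disjoint (V i) (V j)) :
    (Finset.univ.filter fun G : SimpleGraph (Fin n) => ∀ i, IndepFinset G (V i)).card
      * 2 ^ (∑ i, ((V i).card).choose 2) = 2 ^ (n.choose 2) := by
  set A := (⊤ : SimpleGraph (Fin n)).edgeFinset with hA
  set B := (Finset.univ.biUnion fun i => (V i).offDiag.image Sym2.mk.uncurry) with hB
  have hBA : B ⊆ A := by
    intro e he
    simp only [hB, Finset.mem_biUnion, Finset.mem_image, Finset.mem_offDiag, Prod.exists] at he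
    obtain ⟨i, _, x, y, ⟨hx, hy, hxy⟩, rfl⟩ := he
    simp [hA, Function.uncurry, hxy]
  have hAc : A.card = n.choose 2 := by
    rw [hA, SimpleGraph.card_edgeFinset_top_eq_card_choose_two]; simp
  have hBc : B.card = ∑ i, ((V i).card).choose 2 := sc_edges_disj V hV
  have key : (Finset.univ.filter fun G : SimpleGraph (Fin n) => ∀ i, IndepFinset G (V i)).card
      = ((A \ B).powerset).card := by
    refine Finset.card_bij (fun G _ => G.edgeFinset) ?_ ?_ ?_
    · intro G hG
      simp only [Finset.mem_filter, Finset.mem_univ, true_and] at hG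
      rw [Finset.mem_powerset]
      intro e he
      rw [Finset.mem_sdiff]
      refine ⟨?_, ?_⟩
      · exact SimpleGraph.edgeFinset_mono (le_top : G ≤ ⊤) he
      · intro heB
        simp only [hB, Finset.mem_biUnion, Finset.mem_image, Finset.mem_offDiag, Prod.exists] at heB
        obtain ⟨i, _, x, y, ⟨hx, hy, hxy⟩, rfl⟩ := heB
        simp only [Function.uncurry, SimpleGraph.mem_edgeFinset, SimpleGraph.mem_edgeSet] at he
        exact hG i x hx y hy he
    · intro G _ H _ h
      exact SimpleGraph.edgeFinset_inj.mp h
    · intro E hE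
      rw [Finset.mem_powerset] at hE
      have hE' : (SimpleGraph.fromEdgeSet (E : Set (Sym2 (Fin n)))).edgeFinset = E := by
        ext e
        rw [SimpleGraph.mem_edgeFinset, SimpleGraph.edgeSet_fromEdgeSet]
        constructor
        · intro h; exact h.1
        · intro h
          refine ⟨h, ?_⟩
          have := Finset.mem_sdiff.mp (hE h)
          have h1 := this.1
          rw [hA, SimpleGraph.mem_edgeFinset] at h1
          exact SimpleGraph.not_isDiag_of_mem_edgeSet _ h1
      refine ⟨SimpleGraph.fromEdgeSet (E : Set (Sym2 (Fin n))), ?_, by convert hE'⟩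
      simp only [Finset.mem_filter, Finset.mem_univ, true_and]
      intro i v hv w hw hadj
      rw [SimpleGraph.fromEdgeSet_adj] at hadj
      have := Finset.mem_sdiff.mp (hE hadj.1)
      apply this.2
      simp only [hB, Finset.mem_biUnion, Finset.mem_image, Finset.mem_offDiag, Prod.exists]
      exact ⟨i, Finset.mem_univ _, v, w, ⟨hv, hw, hadj.2⟩, rfl⟩
  rw [key, Finset.card_powerset, ← pow_add, Finset.card_sdiff_of_subset hBA, ← hBc, hAc,
    Nat.sub_add_cancel]
  rw [← hAc]; exact Finset.card_le_card hBA

lemma sc_Ep_half (n : ℕ) (X : SimpleGraph (Fin n) → ℝ) :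
    Ep n (1/2) X = (∑ G : SimpleGraph (Fin n), X G) / 2 ^ (n.choose 2) := by
  unfold Ep
  rw [finsum_eq_sum_of_fintype, Finset.sum_div]
  refine Finset.sum_congr rfl fun G _ => ?_
  have hle : edgeCount G ≤ n.choose 2 := by
    unfold edgeCount
    rw [Nat.card_eq_fintype_card, ← SimpleGraph.edgeFinset_card]
    simpa using SimpleGraph.card_edgeFinset_le_card_choose_two (G := G)
  have : (1 - 1/2 : ℝ) = 1/2 := by norm_num
  rw [this, mul_assoc, ← pow_add, Nat.add_sub_cancel' hle]
  simp [div_eq_mul_inv]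

lemma sc_tuple_count {α : Type*} [Fintype α] : ∀ (m : ℕ) (a : Fin m → ℕ) (S : Finset α),
    ∑ i, a i ≤ S.card →
    (Finset.univ.filter fun V : Fin m → Finset α =>
      (∀ i, V i ⊆ S) ∧ (∀ i, (V i).card = a i) ∧ ∀ i j, i ≠ j → Disjoint (V i) (V j)).card
      * (∏ i, (a i).factorial) * (S.card - ∑ i, a i).factorial = S.card.factorial := by
  intro m
  induction m with
  | zero =>
    intro a S h
    simp
  | succ m ih =>
    intro a S h
    rw [Fin.sum_univ_succ] at h
    have key : (Finset.univ.filter fun V : Fin (m+1) → Finset α =>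
      (∀ i, V i ⊆ S) ∧ (∀ i, (V i).card = a i) ∧ ∀ i j, i ≠ j → Disjoint (V i) (V j)).card
      = ∑ W ∈ S.powersetCard (a 0), (Finset.univ.filter fun V : Fin m → Finset α =>
      (∀ i, V i ⊆ S \ W) ∧ (∀ i, (V i).card = a i.succ) ∧
        ∀ i j, i ≠ j → Disjoint (V i) (V j)).card := by
      rw [← Finset.card_sigma]
      refine Finset.card_bij (fun V _ => ⟨V 0, Fin.tail V⟩) ?_ ?_ ?_
      · intro V hV
        simp only [Finset.mem_filter, Finset.mem_univ, true_and] at hV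
        obtain ⟨h1, h2, h3⟩ := hV
        simp only [Finset.mem_sigma, Finset.mem_powersetCard, Finset.mem_filter, Finset.mem_univ,
          true_and]
        refine ⟨⟨h1 0, h2 0⟩, fun i => ?_, fun i => h2 i.succ, fun i j hij => ?_⟩
        · rw [Finset.subset_sdiff]
          exact ⟨h1 _, h3 _ _ (Fin.succ_ne_zero i)⟩
        · exact h3 _ _ (fun h => hij (Fin.succ_injective _ h))
      · intro V _ V' _ h
        rw [Sigma.mk.injEq] at h
        rw [← Fin.cons_self_tail V, ← Fin.cons_self_tail V', h.1, eq_of_heq h.2]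
      · rintro ⟨W, V⟩ h
        simp only [Finset.mem_sigma, Finset.mem_powersetCard, Finset.mem_filter, Finset.mem_univ,
          true_and] at h
        obtain ⟨⟨hW, hWc⟩, h1, h2, h3⟩ := h
        refine ⟨Fin.cons W V, ?_, by simp⟩
        simp only [Finset.mem_filter, Finset.mem_univ, true_and]
        refine ⟨?_, ?_, ?_⟩
        · intro i
          refine Fin.cases ?_ (fun i => ?_) i
          · simpa using hW
          · simpa using (h1 i).trans Finset.sdiff_subset
        · intro i
          refine Fin.cases ?_ (fun i => ?_) i
          · simpa using hWc
          · simpa using h2 i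
        · intro i j
          refine Fin.cases ?_ (fun i => ?_) i <;> refine Fin.cases ?_ (fun j => ?_) j
          · simp
          · intro _
            simpa using ((Finset.subset_sdiff.mp (h1 j)).2).symm
          · intro _
            simpa using ((Finset.subset_sdiff.mp (h1 i)).2)
          · intro hij
            simpa using h3 i j (fun h => hij (by rw [h]))
    have hstep : ∀ W ∈ S.powersetCard (a 0), (Finset.univ.filter fun V : Fin m → Finset α =>
      (∀ i, V i ⊆ S \ W) ∧ (∀ i, (V i).card = a i.succ) ∧
        ∀ i j, i ≠ j → Disjoint (V i) (V j)).card * ((∏ i : Fin m, (a i.succ).factorial) *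
        (S.card - ∑ i, a i).factorial) = (S.card - a 0).factorial := by
      intro W hW
      rw [Finset.mem_powersetCard] at hW
      have hc : (S \ W).card = S.card - a 0 := by
        rw [Finset.card_sdiff_of_subset hW.1, hW.2]
      have := ih (fun i => a i.succ) (S \ W) (by rw [hc]; omega)
      rw [hc] at this
      rw [← mul_assoc, Fin.sum_univ_succ, ← Nat.sub_sub, this]
    rw [key, Fin.prod_univ_succ]
    calc _ = (a 0).factorial * ∑ W ∈ S.powersetCard (a 0), (Finset.univ.filter fun V : Fin m → Finset α =>
      (∀ i, V i ⊆ S \ W) ∧ (∀ i, (V i).card = a i.succ) ∧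
        ∀ i j, i ≠ j → Disjoint (V i) (V j)).card * ((∏ i : Fin m, (a i.succ).factorial) *
        (S.card - ∑ i, a i).factorial) := by
          rw [← Finset.sum_mul]; ring
      _ = (a 0).factorial * (S.card.choose (a 0) * (S.card - a 0).factorial) := by
          rw [Finset.sum_congr rfl hstep, Finset.sum_const, Finset.card_powersetCard, smul_eq_mul]
      _ = S.card.factorial := by
          rw [← Nat.choose_mul_factorial_mul_factorial (show a 0 ≤ S.card by omega)]; ring

lemma sc_exists_sizes (n : ℕ) (P : ℕ → ℕ) (hP : ∀ u, u ∉ Finset.Icc 1 n → P u = 0) :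
    ∃ a : Fin (profileParts n P) → ℕ, (∀ i j, i ≤ j → a j ≤ a i) ∧
      ∀ u : ℕ, (Finset.univ.filter fun i => a i = u).card = P u := by
  have hcard : Fintype.card (Fin (profileParts n P)) =
      Fintype.card (Σ u : Finset.Icc 1 n, Fin (P u)) := by
    rw [Fintype.card_fin, Fintype.card_sigma]
    simp only [Fintype.card_fin, profileParts]
    rw [← Finset.sum_coe_sort]
  let e := Fintype.equivOfCardEq hcard
  let f : Fin (profileParts n P) → ℕ := fun i => ((e i).1 : ℕ)
  have hf : ∀ u : ℕ, (Finset.univ.filter fun i => f i = u).card = P u := by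
    intro u
    by_cases hu : u ∈ Finset.Icc 1 n
    · rw [← Fintype.card_fin (P u), ← Finset.card_univ]
      symm
      refine Finset.card_bij (fun x _ => e.symm ⟨⟨u, hu⟩, x⟩) ?_ ?_ ?_
      · intro x _
        simp [f]
      · intro x _ y _ h
        have := e.symm.injective h
        simpa using this
      · intro i hi
        simp only [Finset.mem_filter, Finset.mem_univ, true_and, f] at hi
        subst hi
        exact ⟨(e i).2, Finset.mem_univ _, by simp⟩
    · rw [hP u hu, Finset.card_eq_zero, Finset.filter_eq_empty_iff]
      intro i _ h
      apply hu
      rw [← h]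
      exact (e i).1.2
  let g : Fin (profileParts n P) → ℕᵒᵈ := fun i => OrderDual.toDual (f i)
  refine ⟨fun i => f (Tuple.sort g i), ?_, ?_⟩
  · intro i j hij
    exact Tuple.monotone_sort g hij
  · intro u
    rw [← hf u]
    refine Finset.card_bij (fun i _ => Tuple.sort g i) ?_ ?_ ?_
    · intro i hi; simpa using hi
    · intro i _ j _ h; exact (Tuple.sort g).injective h
    · intro i hi
      refine ⟨(Tuple.sort g).symm i, ?_, by simp⟩
      simpa using hi

lemma sc_unique_sizes {m : ℕ} (a b : Fin m → ℕ) (ha : ∀ i j, i ≤ j → a j ≤ a i)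
    (hb : ∀ i j, i ≤ j → b j ≤ b i)
    (h : ∀ u : ℕ, (Finset.univ.filter fun i => a i = u).card =
      (Finset.univ.filter fun i => b i = u).card) : a = b := by
  apply List.ofFn_injective
  have hp : (List.ofFn a).Perm (List.ofFn b) := by
    rw [← Multiset.coe_eq_coe, ← Fin.univ_val_map, ← Fin.univ_val_map]
    ext u
    rw [Multiset.count_map, Multiset.count_map]
    have := h u
    simp only [Finset.card_def, Finset.filter_val] at this
    simpa only [eq_comm] using this
  refine hp.eq_of_pairwise (le := fun x y => y ≤ x) ?_ ?_ ?_
  · intro x y _ _ h1 h2; exact le_antisymm h2 h1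
  · rw [List.pairwise_ofFn]; intro i j hij; exact ha i j hij.le
  · rw [List.pairwise_ofFn]; intro i j hij; exact hb i j hij.le

/-- The weight denominator of a profile. -/
def scD (n : ℕ) (P : ℕ → ℕ) : ℝ :=
  ∏ u ∈ Finset.Icc 1 n, (dcoef u ^ P u * ((P u).factorial : ℝ))

lemma sc_fiber_sum {n m : ℕ} (P : ℕ → ℕ) (hP : ∀ u, u ∉ Finset.Icc 1 n → P u = 0)
    (a : Fin m → ℕ) (ha : ∀ u : ℕ, (Finset.univ.filter fun i => a i = u).card = P u)
    (f : ℕ → ℕ) : ∑ i, f (a i) = ∑ u ∈ Finset.Icc 1 n, P u * f u := by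
  have hmem : ∀ i ∈ (Finset.univ : Finset (Fin m)), a i ∈ Finset.Icc 1 n := by
    intro i _
    by_contra hc
    have h0 := hP _ hc
    rw [← ha, Finset.card_eq_zero, Finset.filter_eq_empty_iff] at h0
    exact h0 (Finset.mem_univ i) rfl
  rw [← Finset.sum_fiberwise_of_maps_to hmem]
  refine Finset.sum_congr rfl fun u _ => ?_
  rw [← ha u, ← smul_eq_mul, ← Finset.sum_const]
  refine Finset.sum_congr rfl fun i hi => ?_
  rw [(Finset.mem_filter.mp hi).2]

lemma sc_fiber_prod {n m : ℕ} (P : ℕ → ℕ) (hP : ∀ u, u ∉ Finset.Icc 1 n → P u = 0)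
    (a : Fin m → ℕ) (ha : ∀ u : ℕ, (Finset.univ.filter fun i => a i = u).card = P u)
    (f : ℕ → ℕ) : ∏ i, f (a i) = ∏ u ∈ Finset.Icc 1 n, f u ^ P u := by
  have hmem : ∀ i ∈ (Finset.univ : Finset (Fin m)), a i ∈ Finset.Icc 1 n := by
    intro i _
    by_contra hc
    have h0 := hP _ hc
    rw [← ha, Finset.card_eq_zero, Finset.filter_eq_empty_iff] at h0
    exact h0 (Finset.mem_univ i) rfl
  rw [← Finset.prod_fiberwise_of_maps_to hmem]
  refine Finset.prod_congr rfl fun u _ => ?_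
  rw [← ha u, ← Finset.prod_const]
  refine Finset.prod_congr rfl fun i hi => ?_
  rw [(Finset.mem_filter.mp hi).2]

lemma sc_sum_X {n : ℕ} (P : ℕ → ℕ) (hP : ∀ u, u ∉ Finset.Icc 1 n → P u = 0)
    (hn : ∑ u ∈ Finset.Icc 1 n, u * P u = n) :
    (∑ G : SimpleGraph (Fin n), Xprofile G P) *
      ∏ u ∈ Finset.Icc 1 n, (2 ^ u.choose 2 * u.factorial) ^ P u
      = n.factorial * 2 ^ (n.choose 2) := by
  obtain ⟨a, ha1, ha2⟩ := sc_exists_sizes n P hP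
  set T := Finset.univ.filter fun V : Fin (profileParts n P) → Finset (Fin n) =>
      (∀ i, V i ⊆ Finset.univ) ∧ (∀ i, (V i).card = a i) ∧ ∀ i j, i ≠ j → Disjoint (V i) (V j)
    with hT
  have hsum : ∑ i, a i = n := by
    have := sc_fiber_sum P hP a ha2 (fun u => u)
    exact this.trans ((Finset.sum_congr rfl fun u _ => mul_comm _ _).trans hn)
  have hX : ∀ G : SimpleGraph (Fin n), Xprofile G P =
      (T.filter fun V => ∀ i, IndepFinset G (V i)).card := by
    intro G
    unfold Xprofile
    rw [← Set.ncard_coe_finset]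
    congr 1
    ext V
    simp only [Set.mem_ofPred_eq, Finset.coe_filter, hT, Finset.mem_filter, Finset.mem_univ,
      true_and, Finset.subset_univ, implies_true]
    constructor
    · rintro ⟨h1, h2, h3, h4⟩
      refine ⟨⟨?_, h1⟩, h4⟩
      have := sc_unique_sizes (fun i => (V i).card) a h2 ha1 (fun u => by rw [h3, ha2])
      intro i
      exact congrFun this i
    · rintro ⟨⟨h1, h2⟩, h4⟩
      refine ⟨h2, ?_, ?_, h4⟩
      · intro i j hij
        rw [h1, h1]; exact ha1 i j hij
      · intro u
        simp only [h1]
        exact ha2 u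
  have hTc : T.card * ∏ i, (a i).factorial = n.factorial := by
    have := sc_tuple_count (α := Fin n) _ a Finset.univ (by simp [hsum])
    simpa [hsum, hT] using this
  have hprod : ∏ u ∈ Finset.Icc 1 n, (2 ^ u.choose 2 * u.factorial) ^ P u
      = (∏ i, (a i).factorial) * 2 ^ (∑ i, (a i).choose 2) := by
    rw [← sc_fiber_prod P hP a ha2 (fun u => 2 ^ u.choose 2 * u.factorial),
      Finset.prod_mul_distrib, Finset.prod_pow_eq_pow_sum, mul_comm]
  have hdouble : ∑ G : SimpleGraph (Fin n), Xprofile G P = ∑ V ∈ T,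
      (Finset.univ.filter fun G : SimpleGraph (Fin n) => ∀ i, IndepFinset G (V i)).card := by
    simp only [hX]
    exact Finset.sum_card_bipartiteAbove_eq_sum_card_bipartiteBelow
      (fun (G : SimpleGraph (Fin n)) (V : Fin (profileParts n P) → Finset (Fin n)) =>
        ∀ i, IndepFinset G (V i))
  have hV : ∀ V ∈ T, (Finset.univ.filter fun G : SimpleGraph (Fin n) =>
      ∀ i, IndepFinset G (V i)).card * 2 ^ (∑ i, (a i).choose 2) = 2 ^ (n.choose 2) := by
    intro V hV
    simp only [hT, Finset.mem_filter, Finset.mem_univ, true_and] at hV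
    have := sc_graph_count V hV.2.2
    simpa only [hV.2.1] using this
  rw [hprod, hdouble, mul_comm (∏ i, (a i).factorial), ← mul_assoc, Finset.sum_mul,
    Finset.sum_congr rfl hV, Finset.sum_const, smul_eq_mul, ← hTc]
  ring

lemma sc_dcoef_pos (u : ℕ) : 0 < dcoef u := by
  unfold dcoef; positivity

lemma sc_KT_supp {n k t : ℕ} {P : ℕ → ℕ} (h : IsKTProfile n k t P) :
    ∀ u, u ∉ Finset.Icc 1 n → P u = 0 := by
  intro u hu
  by_contra h0
  have hut : u ∈ Finset.Icc 1 t := by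
    by_contra hc; exact h0 (h.1 u hc)
  have h1 : u * P u ≤ n := by
    rw [← h.2.2]
    exact Finset.single_le_sum (f := fun u => u * P u) (fun _ _ => Nat.zero_le _) hut
  have h2 : u ≤ u * P u := Nat.le_mul_of_pos_right _ (Nat.pos_of_ne_zero h0)
  rw [Finset.mem_Icc] at hu hut
  omega

lemma sc_KT_sum {n k t : ℕ} {P : ℕ → ℕ} (h : IsKTProfile n k t P) :
    ∑ u ∈ Finset.Icc 1 n, u * P u = n := by
  conv_rhs => rw [← h.2.2]
  have h1 := sc_KT_supp h
  have e1 : ∑ u ∈ Finset.Icc 1 n, u * P u = ∑ u ∈ Finset.Icc 1 n ∪ Finset.Icc 1 t, u * P u :=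
    Finset.sum_subset Finset.subset_union_left (fun u _ hu => by rw [h1 u hu, mul_zero])
  have e2 : ∑ u ∈ Finset.Icc 1 t, u * P u = ∑ u ∈ Finset.Icc 1 n ∪ Finset.Icc 1 t, u * P u :=
    Finset.sum_subset Finset.subset_union_right (fun u _ hu => by rw [h.1 u hu, mul_zero])
  rw [e1, e2]

lemma sc_Ep_eq {n k t : ℕ} {P : ℕ → ℕ} (h : IsKTProfile n k t P) :
    (Ep n (1/2) fun G => Xbar G P) = (n.factorial : ℝ) / scD n P := by
  have h1 := sc_sum_X P (sc_KT_supp h) (sc_KT_sum h)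
  have h2 : (∑ G : SimpleGraph (Fin n), (Xprofile G P : ℝ)) *
      ∏ u ∈ Finset.Icc 1 n, dcoef u ^ P u = (n.factorial : ℝ) * 2 ^ (n.choose 2) := by
    have := congrArg (Nat.cast : ℕ → ℝ) h1
    push_cast at this
    simpa only [dcoef] using this
  have hp : 0 < ∏ u ∈ Finset.Icc 1 n, dcoef u ^ P u :=
    Finset.prod_pos fun u _ => pow_pos (sc_dcoef_pos u) _
  have hq : 0 < ∏ u ∈ Finset.Icc 1 n, ((P u).factorial : ℝ) :=
    Finset.prod_pos fun u _ => by positivity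
  rw [sc_Ep_half]
  simp only [Xbar, scD]
  rw [← Finset.sum_div, Finset.prod_mul_distrib, div_div,
    div_eq_div_iff (by positivity) (by positivity)]
  linear_combination (∏ u ∈ Finset.Icc 1 n, ((P u).factorial : ℝ)) * h2

/-- The profile obtained from `P` by replacing one class of size `s` and `r` classes of size
`s + r + 1` by `r + 1` classes of size `s + r`. -/
def scMove (s r : ℕ) (P : ℕ → ℕ) : ℕ → ℕ := fun v =>
  if v = s then P v - 1 else if v = s + r + 1 then P v - r else
    if v = s + r then P v + (r + 1) else P v

lemma sc_move_eq {s r : ℕ} (hr : 1 ≤ r) {P : ℕ → ℕ} (hs : 1 ≤ P s) (hu : r ≤ P (s + r + 1))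
    (v : ℕ) : scMove s r P v + (if v = s then 1 else 0) + (if v = s + r + 1 then r else 0)
      = P v + (if v = s + r then r + 1 else 0) := by
  unfold scMove
  split_ifs <;> (try subst_vars) <;> omega

lemma sc_move_inj {s r : ℕ} (hr : 1 ≤ r) {P Q : ℕ → ℕ} (hs : 1 ≤ P s) (hu : r ≤ P (s + r + 1))
    (hs' : 1 ≤ Q s) (hu' : r ≤ Q (s + r + 1)) (h : scMove s r P = scMove s r Q) : P = Q := by
  funext v
  have h1 := sc_move_eq hr hs hu v
  have h2 := sc_move_eq hr hs' hu' v
  rw [h] at h1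
  omega

lemma sc_move_KT {n k t s r : ℕ} (hr : 1 ≤ r) {P : ℕ → ℕ} (hs : 1 ≤ P s)
    (hu : r ≤ P (s + r + 1)) (h : IsKTProfile n k t P) : IsKTProfile n k t (scMove s r P) := by
  have hsm : s ∈ Finset.Icc 1 t := by
    by_contra hc; have := h.1 s hc; omega
  have hum : s + r + 1 ∈ Finset.Icc 1 t := by
    by_contra hc; have := h.1 _ hc; omega
  have hwm : s + r ∈ Finset.Icc 1 t := by
    rw [Finset.mem_Icc] at *; omega
  refine ⟨?_, ?_, ?_⟩
  · intro v hv
    have h1 := sc_move_eq hr hs hu v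
    have h2 := h.1 v hv
    have h3 : v ≠ s + r := by rintro rfl; exact hv hwm
    rw [if_neg h3] at h1
    omega
  · have h1 : ∑ v ∈ Finset.Icc 1 t, (scMove s r P v + (if v = s then 1 else 0)
        + (if v = s + r + 1 then r else 0)) =
        ∑ v ∈ Finset.Icc 1 t, (P v + (if v = s + r then r + 1 else 0)) :=
      Finset.sum_congr rfl fun v _ => sc_move_eq hr hs hu v
    simp only [Finset.sum_add_distrib, Finset.sum_ite_eq', hsm, hum, hwm, if_true, h.2.1] at h1
    omega
  · have h1 : ∑ v ∈ Finset.Icc 1 t, (v * scMove s r P v + (if v = s then v else 0)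
        + (if v = s + r + 1 then v * r else 0)) =
        ∑ v ∈ Finset.Icc 1 t, (v * P v + (if v = s + r then v * (r + 1) else 0)) := by
      refine Finset.sum_congr rfl fun v _ => ?_
      have := congrArg (fun x => v * x) (sc_move_eq hr hs hu v)
      simpa only [mul_add, mul_ite, mul_zero, mul_one] using this
    simp only [Finset.sum_add_distrib, Finset.sum_ite_eq', hsm, hum, hwm, if_true, h.2.2] at h1
    have : s + (s + r + 1) * r = (s + r) * (r + 1) := by ring
    omega

lemma sc_choose_id (s r : ℕ) :
    (r + 1) * (s + r).choose 2 + (r + 1).choose 2 = s.choose 2 + r * (s + r + 1).choose 2 := by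
  have h : ∀ m : ℕ, ((m.choose 2 : ℕ) : ℚ) = m * (m - 1) / 2 := fun m => Nat.cast_choose_two ℚ m
  have : (((r + 1) * (s + r).choose 2 + (r + 1).choose 2 : ℕ) : ℚ) =
      ((s.choose 2 + r * (s + r + 1).choose 2 : ℕ) : ℚ) := by
    push_cast [h]; ring
  exact_mod_cast this

lemma sc_fact_ineq (s r : ℕ) :
    (s + r).factorial ^ (r + 1) ≤ s.factorial * (s + r + 1).factorial ^ r := by
  have h1 : (s + r).factorial ≤ s.factorial * (s + r + 1) ^ r := by
    rw [← Nat.factorial_mul_ascFactorial]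
    gcongr
    refine (Nat.ascFactorial_le_pow_add s r).trans ?_
    exact Nat.pow_le_pow_left (by omega) r
  rw [Nat.factorial_succ (s + r), mul_pow, pow_succ]
  calc _ ≤ (s + r).factorial ^ r * (s.factorial * (s + r + 1) ^ r) := by gcongr
    _ = _ := by ring

lemma sc_dcoef_ineq (s r : ℕ) :
    2 ^ (r + 1).choose 2 * dcoef (s + r) ^ (r + 1) ≤ dcoef s * dcoef (s + r + 1) ^ r := by
  unfold dcoef
  have h1 : (((s + r).factorial : ℝ)) ^ (r + 1) ≤ s.factorial * ((s + r + 1).factorial : ℝ) ^ r := by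
    exact_mod_cast sc_fact_ineq s r
  have h2 := sc_choose_id s r
  calc (2 : ℝ) ^ (r + 1).choose 2 * (2 ^ (s + r).choose 2 * ((s + r).factorial : ℝ)) ^ (r + 1)
      = 2 ^ ((r + 1) * (s + r).choose 2 + (r + 1).choose 2) * ((s + r).factorial : ℝ) ^ (r + 1) := by
        rw [mul_pow, ← pow_mul, pow_add]; ring
    _ ≤ 2 ^ ((r + 1) * (s + r).choose 2 + (r + 1).choose 2) *
        (s.factorial * ((s + r + 1).factorial : ℝ) ^ r) := by gcongr
    _ = _ := by
        rw [h2, mul_pow, ← pow_mul, pow_add]; ring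

lemma sc_scD_pos (n : ℕ) (P : ℕ → ℕ) : 0 < scD n P :=
  Finset.prod_pos fun u _ => mul_pos (pow_pos (sc_dcoef_pos u) _) (by positivity)

lemma sc_scD_move {n k t s r : ℕ} (hr : 1 ≤ r) {P : ℕ → ℕ} (hs : 1 ≤ P s)
    (hu : r ≤ P (s + r + 1)) (h : IsKTProfile n k t P) (y : ℝ) (hy : 0 ≤ y)
    (hyP : y ≤ (P (s + r + 1) : ℝ) - r) :
    scD n (scMove s r P) * (2 ^ (r + 1).choose 2 * y ^ r) ≤ scD n P * (k : ℝ) ^ (r + 1) := by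
  have hM := sc_move_KT hr hs hu h
  have hsm : s ∈ Finset.Icc 1 n := by
    by_contra hc; have := sc_KT_supp h s hc; omega
  have hum : s + r + 1 ∈ (Finset.Icc 1 n).erase s := by
    refine Finset.mem_erase.mpr ⟨by omega, ?_⟩
    by_contra hc; have := sc_KT_supp h _ hc; omega
  have hwm : s + r ∈ ((Finset.Icc 1 n).erase s).erase (s + r + 1) := by
    refine Finset.mem_erase.mpr ⟨by omega, Finset.mem_erase.mpr ⟨by omega, ?_⟩⟩
    rw [Finset.mem_erase, Finset.mem_Icc] at hum
    rw [Finset.mem_Icc] at *; omega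
  have split : ∀ Q : ℕ → ℕ, scD n Q = (dcoef s ^ Q s * ((Q s).factorial : ℝ)) *
      ((dcoef (s + r + 1) ^ Q (s + r + 1) * ((Q (s + r + 1)).factorial : ℝ)) *
      ((dcoef (s + r) ^ Q (s + r) * ((Q (s + r)).factorial : ℝ)) *
      ∏ u ∈ (((Finset.Icc 1 n).erase s).erase (s + r + 1)).erase (s + r),
        (dcoef u ^ Q u * ((Q u).factorial : ℝ)))) := by
    intro Q
    rw [Finset.mul_prod_erase _ (fun u => dcoef u ^ Q u * ((Q u).factorial : ℝ)) hwm,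
      Finset.mul_prod_erase _ (fun u => dcoef u ^ Q u * ((Q u).factorial : ℝ)) hum,
      Finset.mul_prod_erase _ (fun u => dcoef u ^ Q u * ((Q u).factorial : ℝ)) hsm]
    rfl
  have hrest : ∏ u ∈ (((Finset.Icc 1 n).erase s).erase (s + r + 1)).erase (s + r),
        (dcoef u ^ scMove s r P u * ((scMove s r P u).factorial : ℝ)) =
      ∏ u ∈ (((Finset.Icc 1 n).erase s).erase (s + r + 1)).erase (s + r),
        (dcoef u ^ P u * ((P u).factorial : ℝ)) := by
    refine Finset.prod_congr rfl fun u hu => ?_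
    simp only [Finset.mem_erase] at hu
    have : scMove s r P u = P u := by
      simp [scMove, hu.1, hu.2.1, hu.2.2.1]
    rw [this]
  rw [split, split P, hrest]
  set R := ∏ u ∈ (((Finset.Icc 1 n).erase s).erase (s + r + 1)).erase (s + r),
        (dcoef u ^ P u * ((P u).factorial : ℝ)) with hR
  have hRpos : 0 < R :=
    Finset.prod_pos fun u _ => mul_pos (pow_pos (sc_dcoef_pos u) _) (by positivity)
  obtain ⟨a, ha⟩ := Nat.exists_eq_add_of_le hs
  obtain ⟨b, hb⟩ := Nat.exists_eq_add_of_le hu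
  have e1 : scMove s r P s = a := by simp [scMove, ha]
  have e2 : scMove s r P (s + r + 1) = b := by
    have : s + r + 1 ≠ s := by omega
    simp [scMove, this, hb]
  have e3 : scMove s r P (s + r) = P (s + r) + (r + 1) := by
    have : r ≠ 0 := by omega
    simp [scMove, this]
  have hck : P (s + r) + (r + 1) ≤ k := by
    rw [← e3, ← hM.2.1]
    refine Finset.single_le_sum (f := fun u => scMove s r P u) (fun _ _ => Nat.zero_le _) ?_
    by_contra hc
    have := hM.1 _ hc
    omega
  rw [e1, e2, e3, ha, hb]
  rw [hb] at hyP
  set c := P (s + r)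
  have f1 : ((a.factorial : ℕ) : ℝ) ≤ ((1 + a).factorial : ℝ) := by
    exact_mod_cast Nat.factorial_le (by omega)
  have f2 : (b.factorial : ℝ) * y ^ r ≤ ((r + b).factorial : ℝ) := by
    have hy2 : y ≤ (b : ℝ) + 1 := by push_cast at hyP; linarith
    have g : b.factorial * (b + 1) ^ r ≤ (b + r).factorial := Nat.factorial_mul_pow_le_factorial
    rw [add_comm r b]
    calc (b.factorial : ℝ) * y ^ r ≤ b.factorial * ((b : ℝ) + 1) ^ r := by gcongr
      _ ≤ _ := by exact_mod_cast g
  have f3 : ((c + (r + 1)).factorial : ℝ) ≤ c.factorial * (k : ℝ) ^ (r + 1) := by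
    have g : (c + (r + 1)).factorial ≤ c.factorial * k ^ (r + 1) := by
      rw [← Nat.factorial_mul_ascFactorial]
      gcongr
      exact (Nat.ascFactorial_le_pow_add c (r + 1)).trans (by gcongr)
    exact_mod_cast g
  have f4 := sc_dcoef_ineq s r
  have p1 := sc_dcoef_pos s
  have p2 := sc_dcoef_pos (s + r)
  have p3 := sc_dcoef_pos (s + r + 1)
  set ds := dcoef s
  set dw := dcoef (s + r)
  set du := dcoef (s + r + 1)
  calc ds ^ a * (a.factorial : ℝ) * (du ^ b * (b.factorial : ℝ) *
        (dw ^ (c + (r + 1)) * ((c + (r + 1)).factorial : ℝ) * R)) *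
        (2 ^ (r + 1).choose 2 * y ^ r)
      = (ds ^ a * du ^ b * dw ^ c * R) * ((2 ^ (r + 1).choose 2 * dw ^ (r + 1)) *
        ((a.factorial : ℝ) * (((b.factorial : ℝ) * y ^ r) * ((c + (r + 1)).factorial : ℝ)))) := by
        ring
    _ ≤ (ds ^ a * du ^ b * dw ^ c * R) * ((ds * du ^ r) *
        (((1 + a).factorial : ℝ) * (((r + b).factorial : ℝ) *
          (c.factorial * (k : ℝ) ^ (r + 1))))) := by
        gcongr
    _ = _ := by ring

lemma sc_pigeon {n k t : ℕ} {P : ℕ → ℕ} (h : IsKTProfile n k t P) (hk : 0 < k) (M : ℕ)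
    (hM : (t : ℝ) * k - n ≤ ((M : ℝ) + 1) / 2 * k) :
    ∃ u ∈ Finset.Icc 1 t, t ≤ u + M ∧ (k : ℝ) / (4 * ((M : ℝ) + 1)) ≤ P u := by
  by_contra! hcon
  have hkR : (0 : ℝ) < k := by exact_mod_cast hk
  have h1 : ∑ u ∈ Finset.Icc 1 t, (P u : ℝ) = k := by exact_mod_cast h.2.1
  have h2 : ∑ u ∈ Finset.Icc 1 t, (u : ℝ) * (P u : ℝ) = n := by exact_mod_cast h.2.2
  have h3 : ∑ u ∈ Finset.Icc 1 t, ((t : ℝ) - u) * (P u : ℝ) = t * k - n := by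
    simp only [sub_mul, Finset.sum_sub_distrib, ← Finset.mul_sum, h1, h2]
  set A := (Finset.Icc 1 t).filter (fun u => t ≤ u + M) with hA
  set B := (Finset.Icc 1 t).filter (fun u => ¬ t ≤ u + M) with hB
  have hs1 : ∑ u ∈ A, (P u : ℝ) + ∑ u ∈ B, (P u : ℝ) = k := by
    rw [← h1]; exact Finset.sum_filter_add_sum_filter_not _ _ _
  have hs2 : ∑ u ∈ A, ((t : ℝ) - u) * (P u : ℝ) + ∑ u ∈ B, ((t : ℝ) - u) * (P u : ℝ)
      = t * k - n := by
    rw [← h3]; exact Finset.sum_filter_add_sum_filter_not _ _ _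
  have hAc : A.card ≤ M + 1 := by
    have : A ⊆ Finset.Icc (t - M) t := by
      intro u hu
      simp only [hA, Finset.mem_filter, Finset.mem_Icc] at hu ⊢
      omega
    refine (Finset.card_le_card this).trans ?_
    rw [Nat.card_Icc]; omega
  have hA1 : ∑ u ∈ A, (P u : ℝ) ≤ k / 4 := by
    calc ∑ u ∈ A, (P u : ℝ) ≤ ∑ u ∈ A, (k : ℝ) / (4 * ((M : ℝ) + 1)) := by
          refine Finset.sum_le_sum fun u hu => ?_
          simp only [hA, Finset.mem_filter] at hu
          exact (hcon u hu.1 hu.2).le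
      _ = A.card * ((k : ℝ) / (4 * ((M : ℝ) + 1))) := by rw [Finset.sum_const, nsmul_eq_mul]
      _ ≤ ((M : ℝ) + 1) * ((k : ℝ) / (4 * ((M : ℝ) + 1))) := by
          gcongr; exact_mod_cast hAc
      _ = k / 4 := by field_simp
  have hA2 : 0 ≤ ∑ u ∈ A, ((t : ℝ) - u) * (P u : ℝ) := by
    refine Finset.sum_nonneg fun u hu => ?_
    simp only [hA, Finset.mem_filter, Finset.mem_Icc] at hu
    have : (u : ℝ) ≤ t := by exact_mod_cast hu.1.2
    exact mul_nonneg (by linarith) (by positivity)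
  have hB2 : ((M : ℝ) + 1) * ∑ u ∈ B, (P u : ℝ) ≤ ∑ u ∈ B, ((t : ℝ) - u) * (P u : ℝ) := by
    rw [Finset.mul_sum]
    refine Finset.sum_le_sum fun u hu => ?_
    simp only [hB, Finset.mem_filter, Finset.mem_Icc] at hu
    have : (u : ℝ) + M + 1 ≤ t := by
      have : u + M + 1 ≤ t := by omega
      exact_mod_cast this
    gcongr
    linarith
  have hMpos : (0 : ℝ) < (M : ℝ) + 1 := by positivity
  have : ((M : ℝ) + 1) * (3 / 4 * k) ≤ ((M : ℝ) + 1) * ∑ u ∈ B, (P u : ℝ) := by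
    gcongr; linarith
  have hpos : 0 < ((M : ℝ) + 1) * k := by positivity
  linarith

lemma sc_KT_finite (n k t : ℕ) : {P : ℕ → ℕ | IsKTProfile n k t P}.Finite := by
  have hf : Function.Injective
      (fun P : {P : ℕ → ℕ // IsKTProfile n k t P} =>
        (fun u : Finset.Icc 1 t => (⟨P.1 u, by
          have h := P.2.2.1
          have h2 : P.1 u ≤ ∑ v ∈ Finset.Icc 1 t, P.1 v :=
            Finset.single_le_sum (f := fun v => P.1 v) (fun _ _ => Nat.zero_le _) u.2
          omega⟩ : Fin (k + 1)))) := by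
    rintro ⟨P, hP⟩ ⟨Q, hQ⟩ h
    apply Subtype.ext
    funext u
    by_cases hu : u ∈ Finset.Icc 1 t
    · have := congrFun h ⟨u, hu⟩
      simpa using this
    · change P u = Q u
      rw [hP.1 u hu, hQ.1 u hu]
  have : Finite {P : ℕ → ℕ // IsKTProfile n k t P} := Finite.of_injective _ hf
  exact Set.finite_coe_iff.mp this

lemma sc_step {n k t M : ℕ} {L : ℝ} {P : ℕ → ℕ} (hn : 0 < n)
    (h : IsKTProfile n k t P) (hbad : ∃ s : ℕ, 0 < P s ∧ (s : ℝ) < L)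
    (hM : (t : ℝ) * k - n ≤ ((M : ℝ) + 1) / 2 * k)
    (ht : (t : ℝ) ^ 2 * (8 * ((M : ℝ) + 1)) ≤ n)
    (hL : 0 ≤ (t : ℝ) - M - 1 - L)
    (hr : ∀ r : ℕ, (t : ℝ) - M - 1 - L < r →
      (n : ℝ) ^ 4 ≤ 2 ^ (r + 1).choose 2 * (1 / (8 * ((M : ℝ) + 1))) ^ r) :
    ∃ p : ℕ × ℕ, p ∈ Finset.Icc 1 t ×ˢ Finset.Icc 1 t ∧ 1 ≤ p.2 ∧ 1 ≤ P p.1 ∧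
      p.2 ≤ P (p.1 + p.2 + 1) ∧ scD n (scMove p.1 p.2 P) * (n : ℝ) ^ 3 ≤ scD n P := by
  have hk : 0 < k := by
    rcases Nat.eq_zero_or_pos k with h0 | h0
    · exfalso
      have h1 := h.2.1
      rw [h0, Finset.sum_eq_zero_iff] at h1
      have h2 := h.2.2
      rw [Finset.sum_eq_zero (fun u hu => by rw [h1 u hu, mul_zero])] at h2
      omega
    · exact h0
  have hkn : k ≤ n := by
    rw [← h.2.1, ← h.2.2]
    refine Finset.sum_le_sum fun u hu => ?_
    rw [Finset.mem_Icc] at hu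
    exact Nat.le_mul_of_pos_left _ (by omega)
  have hntk : n ≤ t * k := by
    conv_lhs => rw [← h.2.2]
    rw [← h.2.1, Finset.mul_sum]
    refine Finset.sum_le_sum fun u hu => ?_
    rw [Finset.mem_Icc] at hu
    exact Nat.mul_le_mul_right _ hu.2
  obtain ⟨s, hs, hsL⟩ := hbad
  obtain ⟨u, hu, htu, hPu⟩ := sc_pigeon h hk M hM
  have hsm : s ∈ Finset.Icc 1 t := by
    by_contra hc; have := h.1 s hc; omega
  have htuR : (t : ℝ) ≤ u + M := by exact_mod_cast htu
  have hsu : s + 1 < u := by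
    have : (s : ℝ) + 1 < u := by linarith
    exact_mod_cast this
  obtain ⟨r, hur⟩ : ∃ r, u = s + r + 1 := ⟨u - s - 1, by omega⟩
  subst hur
  have hr1 : 1 ≤ r := by omega
  have hMp : (0 : ℝ) < 8 * ((M : ℝ) + 1) := by positivity
  have htR : (0 : ℝ) < t := by
    have : 0 < t := by rw [Finset.mem_Icc] at hsm; omega
    exact_mod_cast this
  have hkR : (0 : ℝ) < k := by exact_mod_cast hk
  have hnR : (0 : ℝ) < n := by exact_mod_cast hn
  have htk : (t : ℝ) ≤ k / (8 * ((M : ℝ) + 1)) := by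
    rw [le_div_iff₀ hMp]
    have h1 : (n : ℝ) ≤ t * k := by exact_mod_cast hntk
    have h2 : (t : ℝ) * (t * (8 * ((M : ℝ) + 1))) ≤ t * k := by nlinarith
    exact le_of_mul_le_mul_left h2 htR
  have hrt : r ≤ t := by rw [Finset.mem_Icc] at hu; omega
  have hrtR : (r : ℝ) ≤ t := by exact_mod_cast hrt
  have h48 : (k : ℝ) / (4 * ((M : ℝ) + 1)) = k / (8 * ((M : ℝ) + 1)) + k / (8 * ((M : ℝ) + 1)) := by
    field_simp; norm_num
  have hy : 1 / (8 * ((M : ℝ) + 1)) * k ≤ (P (s + r + 1) : ℝ) - r := by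
    have : 1 / (8 * ((M : ℝ) + 1)) * k = k / (8 * ((M : ℝ) + 1)) := by ring
    rw [this]; linarith
  have hrP : r ≤ P (s + r + 1) := by
    have h0 : 0 ≤ 1 / (8 * ((M : ℝ) + 1)) * k := by positivity
    have : (r : ℝ) ≤ P (s + r + 1) := by linarith
    exact_mod_cast this
  refine ⟨(s, r), ?_, hr1, hs, hrP, ?_⟩
  · rw [Finset.mem_product]
    exact ⟨hsm, Finset.mem_Icc.mpr ⟨hr1, hrt⟩⟩
  · have key := sc_scD_move hr1 hs hrP h _ (by positivity) hy
    have hg := hr r (by push_cast at htuR; linarith)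
    have hpos := sc_scD_pos n (scMove s r P)
    have hpos' := sc_scD_pos n P
    have k1 : scD n (scMove s r P) * (n : ℝ) ^ 4 * (k : ℝ) ^ r ≤ scD n P * k * (k : ℝ) ^ r := by
      calc scD n (scMove s r P) * (n : ℝ) ^ 4 * (k : ℝ) ^ r
          ≤ scD n (scMove s r P) * (2 ^ (r + 1).choose 2 * (1 / (8 * ((M : ℝ) + 1))) ^ r)
            * (k : ℝ) ^ r := by gcongr
        _ = scD n (scMove s r P) * (2 ^ (r + 1).choose 2 *
            (1 / (8 * ((M : ℝ) + 1)) * k) ^ r) := by rw [mul_pow]; ring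
        _ ≤ _ := key
        _ = _ := by ring
    have k2 := le_of_mul_le_mul_right k1 (by positivity)
    have k3 : scD n P * k ≤ scD n P * n := by gcongr
    have k4 : (scD n (scMove s r P) * (n : ℝ) ^ 3) * n ≤ scD n P * n := by
      calc _ = scD n (scMove s r P) * (n : ℝ) ^ 4 := by ring
        _ ≤ _ := k2.trans k3
    exact le_of_mul_le_mul_right k4 hnR

lemma sc_core {n k t M : ℕ} {L : ℝ} (hn : 0 < n)
    (hM : (t : ℝ) * k - n ≤ ((M : ℝ) + 1) / 2 * k)
    (ht : (t : ℝ) ^ 2 * (8 * ((M : ℝ) + 1)) ≤ n)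
    (hL : 0 ≤ (t : ℝ) - M - 1 - L)
    (hr : ∀ r : ℕ, (t : ℝ) - M - 1 - L < r →
      (n : ℝ) ^ 4 ≤ 2 ^ (r + 1).choose 2 * (1 / (8 * ((M : ℝ) + 1))) ^ r) :
    0 ≤ (∑ᶠ P : ℕ → ℕ, if IsKTProfile n k t P ∧ ∃ s : ℕ, 0 < P s ∧ (s : ℝ) < L
        then Ep n (1/2) fun G => Xbar G P else 0) ∧
    0 ≤ EnktSum n k t ∧
    (∑ᶠ P : ℕ → ℕ, if IsKTProfile n k t P ∧ ∃ s : ℕ, 0 < P s ∧ (s : ℝ) < L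
        then Ep n (1/2) fun G => Xbar G P else 0) ≤ 1 / (n : ℝ) * EnktSum n k t := by
  set S := (sc_KT_finite n k t).toFinset with hS
  have hmem : ∀ P, P ∈ S ↔ IsKTProfile n k t P := fun P => by simp [hS]
  set B := S.filter (fun P => ∃ s : ℕ, 0 < P s ∧ (s : ℝ) < L) with hB
  have e1 : EnktSum n k t = ∑ P ∈ S, (n.factorial : ℝ) / scD n P := by
    unfold EnktSum
    rw [finsum_eq_sum_of_support_subset (s := S)]
    · refine Finset.sum_congr rfl fun P hP => ?_
      rw [hmem] at hP
      rw [if_pos hP, sc_Ep_eq hP]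
    · intro P hP
      rw [Finset.mem_coe, hmem]
      by_contra hc
      exact hP (if_neg hc)
  have e2 : (∑ᶠ P : ℕ → ℕ, if IsKTProfile n k t P ∧ ∃ s : ℕ, 0 < P s ∧ (s : ℝ) < L
        then Ep n (1/2) fun G => Xbar G P else 0) = ∑ P ∈ B, (n.factorial : ℝ) / scD n P := by
    rw [finsum_eq_sum_of_support_subset (s := B)]
    · refine Finset.sum_congr rfl fun P hP => ?_
      rw [hB, Finset.mem_filter, hmem] at hP
      rw [if_pos hP, sc_Ep_eq hP.1]
    · intro P hP
      rw [Finset.mem_coe, hB, Finset.mem_filter, hmem]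
      by_contra hc
      exact hP (if_neg hc)
  have hWnn : ∀ P, 0 ≤ (n.factorial : ℝ) / scD n P := fun P =>
    div_nonneg (by positivity) (sc_scD_pos n P).le
  have hnR : (0 : ℝ) < n := by exact_mod_cast hn
  rw [e1, e2]
  refine ⟨Finset.sum_nonneg fun P _ => hWnn P, Finset.sum_nonneg fun P _ => hWnn P, ?_⟩
  have hstep : ∀ P : ℕ → ℕ, ∃ p : ℕ × ℕ, P ∈ B → (p ∈ Finset.Icc 1 t ×ˢ Finset.Icc 1 t ∧ 1 ≤ p.2 ∧
      1 ≤ P p.1 ∧ p.2 ≤ P (p.1 + p.2 + 1) ∧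
      scD n (scMove p.1 p.2 P) * (n : ℝ) ^ 3 ≤ scD n P) := by
    intro P
    by_cases hP : P ∈ B
    · have hP' := hP
      rw [hB, Finset.mem_filter, hmem] at hP'
      obtain ⟨p, hp⟩ := sc_step hn hP'.1 hP'.2 hM ht hL hr
      exact ⟨p, fun _ => hp⟩
    · exact ⟨(0, 0), fun h => absurd h hP⟩
  choose p hp using hstep
  let Φ : (ℕ → ℕ) → (ℕ × ℕ) × (ℕ → ℕ) := fun P => (p P, scMove (p P).1 (p P).2 P)
  have hinj : Set.InjOn Φ B := by
    intro P hP Q hQ h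
    obtain ⟨_, hP1, hP2, hP3, _⟩ := hp P hP
    obtain ⟨_, _, hQ2, hQ3, _⟩ := hp Q hQ
    simp only [Φ, Prod.mk.injEq] at h
    obtain ⟨h1, h2⟩ := h
    rw [← h1] at h2 hQ2 hQ3
    exact sc_move_inj hP1 hP2 hP3 hQ2 hQ3 h2
  have htn : (t : ℝ) ^ 2 ≤ n := by
    have hM1 : (1 : ℝ) ≤ 8 * ((M : ℝ) + 1) := by
      have : (0 : ℝ) ≤ M := by positivity
      linarith
    calc (t : ℝ) ^ 2 = (t : ℝ) ^ 2 * 1 := by ring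
      _ ≤ (t : ℝ) ^ 2 * (8 * ((M : ℝ) + 1)) := by gcongr
      _ ≤ n := ht
  have hSnn : 0 ≤ ∑ P ∈ S, (n.factorial : ℝ) / scD n P := Finset.sum_nonneg fun P _ => hWnn P
  calc ∑ P ∈ B, (n.factorial : ℝ) / scD n P
      ≤ ∑ P ∈ B, 1 / (n : ℝ) ^ 3 * ((n.factorial : ℝ) / scD n (Φ P).2) := by
        refine Finset.sum_le_sum fun P hP => ?_
        obtain ⟨_, _, _, _, h⟩ := hp P hP
        have p1 := sc_scD_pos n P
        have p2 := sc_scD_pos n (scMove (p P).1 (p P).2 P)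
        change _ ≤ 1 / (n : ℝ) ^ 3 * ((n.factorial : ℝ) / scD n (scMove (p P).1 (p P).2 P))
        rw [div_mul_div_comm, one_mul]
        gcongr
        linarith
    _ = ∑ q ∈ B.image Φ, 1 / (n : ℝ) ^ 3 * ((n.factorial : ℝ) / scD n q.2) := by
        rw [Finset.sum_image hinj]
    _ ≤ ∑ q ∈ (Finset.Icc 1 t ×ˢ Finset.Icc 1 t) ×ˢ S,
          1 / (n : ℝ) ^ 3 * ((n.factorial : ℝ) / scD n q.2) := by
        refine Finset.sum_le_sum_of_subset_of_nonneg ?_ ?_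
        · intro q hq
          obtain ⟨P, hP, rfl⟩ := Finset.mem_image.mp hq
          obtain ⟨h1, h2, h3, h4, _⟩ := hp P hP
          rw [Finset.mem_product, hmem]
          refine ⟨h1, ?_⟩
          rw [hB, Finset.mem_filter, hmem] at hP
          exact sc_move_KT h2 h3 h4 hP.1
        · intro q _ _
          have := hWnn q.2
          positivity
    _ = (t : ℝ) ^ 2 * (1 / (n : ℝ) ^ 3 * ∑ P ∈ S, (n.factorial : ℝ) / scD n P) := by
        rw [Finset.sum_product]
        simp only [← Finset.mul_sum]
        rw [Finset.sum_const, Finset.card_product, Nat.card_Icc, nsmul_eq_mul, Nat.add_sub_cancel]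
        push_cast
        ring
    _ ≤ (n : ℝ) * (1 / (n : ℝ) ^ 3 * ∑ P ∈ S, (n.factorial : ℝ) / scD n P) := by gcongr
    _ = 1 / (n : ℝ) * (1 / (n : ℝ) * ∑ P ∈ S, (n.factorial : ℝ) / scD n P) := by
        field_simp
    _ ≤ 1 / (n : ℝ) * (1 * ∑ P ∈ S, (n.factorial : ℝ) / scD n P) := by
        have : 1 / (n : ℝ) ≤ 1 := by
          rw [div_le_one hnR]; exact_mod_cast hn
        gcongr
    _ = _ := by ring

lemma sc_alpha_bound : ∀ K : ℝ, ∀ᶠ n : ℕ in atTop,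
    ((alphaNat 2 n : ℝ) + |K|) ^ 2 * |K| ≤ n := by
  intro K
  have hlog : (fun x : ℝ => Real.log x ^ 2) =o[atTop] (fun x : ℝ => x) :=
    Real.isLittleO_pow_log_id_atTop
  have hlogT : Tendsto (fun n : ℕ => Real.log (n : ℝ)) atTop atTop :=
    Real.tendsto_log_atTop.comp tendsto_natCast_atTop_atTop
  set A : ℝ := 16 * (|K| + 1) with hA
  have hApos : 0 < A := by positivity
  have hb := (hlog.comp_tendsto tendsto_natCast_atTop_atTop).bound
    (show (0:ℝ) < 1 / A by positivity)
  filter_upwards [hb, hlogT.eventually_ge_atTop (10 + |K|), eventually_ge_atTop 2] with n h1 h2 h3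
  simp only [Function.comp, Real.norm_eq_abs] at h1
  rw [abs_of_nonneg (sq_nonneg _), abs_of_nonneg (by positivity : (0:ℝ) ≤ (n : ℝ))] at h1
  have hK := abs_nonneg K
  have l2 : 0.69 < Real.log 2 := by linarith [Real.log_two_gt_d9]
  have l2' : Real.log 2 < 0.7 := by linarith [Real.log_two_lt_d9]
  have hlb : Real.logb 2 n ≤ 1.5 * Real.log n := by
    unfold Real.logb
    rw [div_le_iff₀ (by linarith)]
    nlinarith
  have hlb1 : 1 ≤ Real.logb 2 n := by
    unfold Real.logb
    rw [le_div_iff₀ (by linarith)]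
    linarith
  have hll : 0 ≤ Real.logb 2 (Real.logb 2 n) := Real.logb_nonneg (by norm_num) hlb1
  have hle : Real.logb 2 (Real.exp 1 / 2) ≤ 1 := by
    unfold Real.logb
    rw [div_le_iff₀ (by linarith), Real.log_div (Real.exp_pos 1).ne' (by norm_num), Real.log_exp]
    linarith
  have ha : (alphaNat 2 n : ℝ) ≤ 3 * Real.log n + 3 := by
    unfold alphaNat
    rcases le_or_gt 0 (alpha0 2 n) with h0 | h0
    · refine (Nat.floor_le h0).trans ?_
      unfold alpha0
      linarith
    · rw [Nat.floor_of_nonpos h0.le]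
      simp; linarith
  have ha0 : (0 : ℝ) ≤ alphaNat 2 n := by positivity
  have h4 : (alphaNat 2 n : ℝ) + |K| ≤ 4 * Real.log n := by linarith
  calc ((alphaNat 2 n : ℝ) + |K|) ^ 2 * |K| ≤ (4 * Real.log n) ^ 2 * (|K| + 1) := by
        gcongr; linarith
    _ = A * Real.log n ^ 2 := by rw [hA]; ring
    _ ≤ A * (1 / A * n) := by gcongr
    _ = n := by field_simp

lemma sc_gain (β K : ℝ) (hβ : 0 < β) : ∀ᶠ n : ℕ in atTop, ∀ r : ℕ,
    10 * Real.sqrt (Real.log n) - K < r → (n : ℝ) ^ 4 ≤ 2 ^ (r + 1).choose 2 * β ^ r := by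
  have hlogT : Tendsto (fun n : ℕ => Real.sqrt (Real.log (n : ℝ))) atTop atTop :=
    Real.tendsto_sqrt_atTop.comp
      (Real.tendsto_log_atTop.comp tendsto_natCast_atTop_atTop)
  filter_upwards [hlogT.eventually_ge_atTop (|K| + 10 * |Real.log β| + 1), eventually_ge_atTop 2]
    with n h1 h2 r hr
  set q := Real.sqrt (Real.log n) with hq
  have hn1 : (1 : ℝ) ≤ n := by exact_mod_cast (by omega : 1 ≤ n)
  have hnp : (0 : ℝ) < n := by linarith
  have hqq : q ^ 2 = Real.log n := Real.sq_sqrt (Real.log_nonneg hn1)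
  have hK := le_abs_self K
  have hb := neg_abs_le (Real.log β)
  have hK0 := abs_nonneg K
  have hb0 := abs_nonneg (Real.log β)
  have hr9 : 9 * q ≤ r := by linarith
  have l2 : 0.69 < Real.log 2 := by linarith [Real.log_two_gt_d9]
  rw [← Real.log_le_log_iff (by positivity) (by positivity), Real.log_pow,
    Real.log_mul (by positivity) (by positivity), Real.log_pow, Real.log_pow,
    Nat.cast_choose_two]
  push_cast
  have hq0 : 1 ≤ q := by linarith
  have hrb : 10 * |Real.log β| ≤ r := by linarith
  have hr0 : (0 : ℝ) ≤ r := by linarith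
  have a1 : (r : ℝ) * Real.log β ≥ - (r * (r / 10)) := by nlinarith
  have a2 : ((r : ℝ) + 1) * (r + 1 - 1) / 2 * Real.log 2 ≥ r * r / 2 * 0.69 := by
    have : (0:ℝ) ≤ r * r / 2 := by positivity
    have : (r : ℝ) * r / 2 ≤ ((r : ℝ) + 1) * (r + 1 - 1) / 2 := by nlinarith
    nlinarith
  have a3 : 81 * q ^ 2 ≤ (r : ℝ) * r := by nlinarith
  rw [← hqq]
  nlinarith
/-- Lemma 7.25: profiles containing a colour class of size smaller than `α − 10√(ln n)`
contribute negligibly to `E_{n,k,t}`. -/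
theorem small_classes_negligible (k t : ℕ → ℕ)
    (ht : ∃ C : ℝ, ∀ᶠ n : ℕ in atTop, |(alphaNat 2 n : ℝ) - (t n : ℝ)| ≤ C)
    (hk : ∃ c₁ c₂ : ℝ, 0 < c₁ ∧ c₁ ≤ c₂ ∧ ∀ᶠ n : ℕ in atTop,
      c₁ ≤ (t n : ℝ) - (n : ℝ) / (k n : ℝ) ∧ (t n : ℝ) - (n : ℝ) / (k n : ℝ) ≤ c₂) :
    (fun n : ℕ => ∑ᶠ P : ℕ → ℕ,
        if IsKTProfile n (k n) (t n) P ∧ ∃ s : ℕ, 0 < P s ∧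
            (s : ℝ) < (alphaNat 2 n : ℝ) - 10 * Real.sqrt (Real.log n)
        then Ep n (1/2) fun G => Xbar G P else 0)
      =o[atTop] fun n : ℕ => EnktSum n (k n) (t n) := by
  obtain ⟨C, hC⟩ := ht
  obtain ⟨c₁, c₂, _, _, hc⟩ := hk
  obtain ⟨M, hM⟩ := exists_nat_ge (2 * |c₂|)
  set K : ℝ := |C| + 8 * ((M : ℝ) + 1) with hK
  have hM0 : (0 : ℝ) ≤ M := by positivity
  have hKpos : 0 < K := by positivity
  have hC0 := abs_nonneg C
  have hCl := le_abs_self C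
  have hsqT : Tendsto (fun n : ℕ => Real.sqrt (Real.log (n : ℝ))) atTop atTop :=
    Real.tendsto_sqrt_atTop.comp
      (Real.tendsto_log_atTop.comp tendsto_natCast_atTop_atTop)
  rw [Asymptotics.isLittleO_iff]
  intro ε hε
  obtain ⟨N, hN⟩ := exists_nat_ge (1 / ε)
  filter_upwards [hC, hc, sc_alpha_bound K, sc_gain (1 / (8 * ((M : ℝ) + 1))) K (by positivity),
    hsqT.eventually_ge_atTop K, eventually_ge_atTop (N + 1)] with n h1 h2 h3 h4 h5 h6
  have hnpos : 0 < n := by omega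
  have hnR : (0 : ℝ) < n := by exact_mod_cast hnpos
  rw [abs_of_pos hKpos] at h3
  have h1' := abs_le.mp h1
  have core := sc_core (n := n) (k := k n) (t := t n) (M := M)
    (L := (alphaNat 2 n : ℝ) - 10 * Real.sqrt (Real.log n)) hnpos ?_ ?_ ?_ ?_
  · obtain ⟨g1, g2, g3⟩ := core
    rw [Real.norm_of_nonneg g1, Real.norm_of_nonneg g2]
    refine g3.trans ?_
    gcongr
    rw [div_le_comm₀ hnR hε]
    refine hN.trans ?_
    exact_mod_cast (by omega : N ≤ n)
  · rcases Nat.eq_zero_or_pos (k n) with h0 | h0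
    · rw [h0]; simp
    · have hkR : (0 : ℝ) < k n := by exact_mod_cast h0
      have h7 : ((t n : ℝ) - n / k n) * k n ≤ c₂ * k n := by gcongr; exact h2.2
      have h8 : ((t n : ℝ) - n / k n) * k n = t n * k n - n := by field_simp
      rw [← h8]
      refine h7.trans ?_
      gcongr
      linarith [le_abs_self c₂]
  · refine le_trans ?_ h3
    gcongr <;> linarith
  · linarith
  · intro r hr
    exact h4 r (by linarith)
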